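/- arXiv:2410.11352 — 6 statements merged into one kernel-verified Lean document; each statement's English description precedes it below -/
import Mathlib

section
/- Uniqueness of the advection operator (core of Theorem 3.1): Let V be a type, E : V → V → Prop a directed graph, and ω : V → V → ℝ with ω v u > 0 whenever E v u. Assume N⁺(v) = {u : E v u} is finite for every v, and write deg⁺(v) for its cardinality. Suppose a : V → V → ℝ satisfies: (i) a u v = 0 unless u = v or E v u; (ii) for every v, a v v + ∑_{u ∈ N⁺(v)} a u v = 0; (iii) for every v with N⁺(v) ≠ ∅, ∑_{u ∈ N⁺(v)} ω v u · a u v = −1; (iv) for every v and all u, w ∈ N⁺(v), ω v u · a u v = ω v w · a w v. Then for every v with N⁺(v) ≠ ∅ and every u ∈ N⁺(v) one has a u v = −1/(deg⁺(v) · ω v u) and a v v = ∑_{w ∈ N⁺(v)} 1/(deg⁺(v) · ω v w); and for every v with N⁺(v) = ∅ one has a u v = 0 for all u. -/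
/-- Uniqueness of the advection operator (core of Theorem 3.1). -/
theorem advection_operator_uniqueness
    {V : Type*} (E : V → V → Prop) (ω : V → V → ℝ)
    (hω : ∀ v u, E v u → 0 < ω v u)
    (hfin : ∀ v : V, {u | E v u}.Finite)
    (a : V → V → ℝ)
    -- (i) a u v = 0 unless u = v or E v u
    (h1 : ∀ u v, u ≠ v → ¬ E v u → a u v = 0)
    -- (ii) column sums vanish
    (h2 : ∀ v, a v v + ∑ u ∈ (hfin v).toFinset, a u v = 0)
    -- (iii) unit speed
    (h3 : ∀ v, {u | E v u}.Nonempty →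
      ∑ u ∈ (hfin v).toFinset, ω v u * a u v = -1)
    -- (iv) splitting
    (h4 : ∀ v u w, E v u → E v w → ω v u * a u v = ω v w * a w v) :
    (∀ v, {u | E v u}.Nonempty →
      (∀ u, E v u → a u v = -1 / (((hfin v).toFinset.card : ℝ) * ω v u)) ∧
      a v v = ∑ w ∈ (hfin v).toFinset, 1 / (((hfin v).toFinset.card : ℝ) * ω v w)) ∧
    (∀ v, ¬ {u | E v u}.Nonempty → ∀ u, a u v = 0) := by
  have hout : ∀ v u, E v u →
      a u v = -1 / (((hfin v).toFinset.card : ℝ) * ω v u) := by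
    intro v u hu
    have hsum : ((hfin v).toFinset.card : ℝ) * (ω v u * a u v) = -1 := by
      rw [← h3 v ⟨u, hu⟩, ← nsmul_eq_mul, ← Finset.sum_const]
      exact Finset.sum_congr rfl fun w hw => h4 v u w hu (by simpa using hw)
    have hcard : ((hfin v).toFinset.card : ℝ) ≠ 0 := by
      intro h
      simp [h] at hsum
    rw [eq_div_iff (mul_ne_zero hcard (hω v u hu).ne'), ← hsum]
    ring
  refine ⟨fun v _ => ⟨hout v, ?_⟩, fun v hv u => ?_⟩
  · rw [eq_neg_of_add_eq_zero_left (h2 v), ← Finset.sum_neg_distrib]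
    refine Finset.sum_congr rfl fun w hw => ?_
    rw [hout v w (by simpa using hw), neg_div, neg_neg]
  · by_cases huv : u = v
    · subst huv
      have hempty : (hfin u).toFinset = ∅ := by
        simpa [Set.not_nonempty_iff_eq_empty] using hv
      simpa [hempty] using h2 u
    · exact h1 u v huv fun hu => hv ⟨u, hu⟩
end

section
/- First part of the ℓ¹-boundedness lemma (Lemma 2.6): Under the matrix-operator hypotheses, assume a u v ≤ 0 for all u ≠ v and ∑_u a u v = 0 for every v (a finite sum). Then for every f : V → ℝ in ℓ¹, the function A f (given by (A f)(u) = ∑_v a u v · f(v)) is in ℓ¹ and ‖A f‖₁ ≤ 2 ‖A‖ · ‖f‖₁, where ‖A‖ is the operator norm of A on ℓ∞(V). -/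
open scoped ENNReal

/-- A zero-sum summable family that is nonpositive away from `v` has absolute sum
`2 * g v`. -/
theorem hasSum_abs_of_nonpos_off_diag {V : Type*} {g : V → ℝ} {v : V} (hg : HasSum g 0)
    (hneg : ∀ u, u ≠ v → g u ≤ 0) : HasSum (fun u => |g u|) (2 * g v) := by
  classical
  have hs : HasSum (fun u => if u = v then g v else 0) (g v) := hasSum_ite_eq v (g v)
  have hv : 0 ≤ g v := by
    have h := (hs.sub hg).nonneg fun u => ?_
    · simpa using h
    · by_cases hu : u = v
      · simp [hu]
      · simpa [hu] using hneg u hu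
  have habs : (fun u => |g u|) = fun u => 2 * (if u = v then g v else 0) - g u := by
    funext u
    by_cases hu : u = v
    · subst hu
      simp only [if_true, abs_of_nonneg hv]
      ring
    · simp [hu, abs_of_nonpos (hneg u hu)]
  rw [habs]
  simpa using (hs.mul_left 2).sub hg

/-- The diagonal entries of a matrix operator on `ℓ∞` are bounded by its norm. -/
theorem diag_le_opNorm {V : Type*} {a : V → V → ℝ}
    {A : lp (fun _ : V => ℝ) ∞ →L[ℝ] lp (fun _ : V => ℝ) ∞}
    (hA : ∀ (f : lp (fun _ : V => ℝ) ∞) (u : V), A f u = ∑' v, a u v * f v) (v : V) :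
    a v v ≤ ‖A‖ := by
  classical
  have h1 : A (lp.single ∞ v (1 : ℝ)) v = a v v := by
    rw [hA, tsum_eq_single v]
    · simp
    · intro w hw
      simp [hw]
  calc a v v ≤ ‖A (lp.single ∞ v (1 : ℝ)) v‖ := h1 ▸ le_abs_self _
    _ ≤ ‖A (lp.single ∞ v (1 : ℝ))‖ := lp.norm_apply_le_norm (by simp) _ v
    _ ≤ ‖A‖ * ‖lp.single (E := fun _ : V => ℝ) ∞ v (1 : ℝ)‖ := A.le_opNorm _
    _ = ‖A‖ := by rw [lp.norm_single (by simp)]; simp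

/-- A matrix whose columns have absolute sums at most `C` acts on `ℓ¹` with norm at most `C`. -/
theorem l1_bound_of_column_bound {U V : Type*} {a : U → V → ℝ} {C : ℝ}
    (hs : ∀ v, Summable fun u => |a u v|) (hC : ∀ v, ∑' u, |a u v| ≤ C)
    {f : V → ℝ} (hf : Summable fun v => |f v|) :
    Summable (fun u => |∑' v, a u v * f v|) ∧
      ∑' u, |∑' v, a u v * f v| ≤ C * ∑' v, |f v| := by
  have hcol : ∀ v, ∑' u, |a u v * f v| ≤ C * |f v| := fun v => by
    simp only [abs_mul, tsum_mul_right]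
    exact mul_le_mul_of_nonneg_right (hC v) (abs_nonneg _)
  have hsum : Summable fun v => ∑' u, |a u v * f v| :=
    Summable.of_nonneg_of_le (fun v => tsum_nonneg fun u => abs_nonneg _) hcol (hf.mul_left C)
  have hprod : Summable fun p : V × U => |a p.2 p.1 * f p.1| := by
    refine (summable_prod_of_nonneg fun p => abs_nonneg _).2 ⟨fun v => ?_, hsum⟩
    simpa only [abs_mul] using (hs v).mul_right |f v|
  have hprod' : Summable fun p : U × V => |a p.1 p.2 * f p.2| := hprod.prod_symm
  have hrow : ∀ u, |∑' v, a u v * f v| ≤ ∑' v, |a u v * f v| := fun u =>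
    norm_tsum_le_tsum_norm (f := fun v => a u v * f v) (hprod'.prod_factor u)
  have hres : Summable fun u => |∑' v, a u v * f v| :=
    Summable.of_nonneg_of_le (fun u => abs_nonneg _) hrow hprod'.prod
  refine ⟨hres, ?_⟩
  calc ∑' u, |∑' v, a u v * f v| ≤ ∑' u, ∑' v, |a u v * f v| := hres.tsum_le_tsum hrow hprod'.prod
    _ = ∑' v, ∑' u, |a u v * f v| := hprod.tsum_comm (f := fun v u => |a u v * f v|)
    _ ≤ ∑' v, C * |f v| := hsum.tsum_le_tsum hcol (hf.mul_left C)
    _ = C * ∑' v, |f v| := tsum_mul_left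

/-- First part of the ℓ¹-boundedness lemma (Lemma 2.6): under the matrix-operator
hypotheses, if the off-diagonal entries are nonpositive and every column sums to zero,
then the matrix action maps ℓ¹ to ℓ¹ with `‖A f‖₁ ≤ 2 ‖A‖ ‖f‖₁`. -/
theorem l1_boundedness_lemma
    {V : Type*} [Countable V]
    (E : V → V → Prop) (Δ : ℕ)
    (hfin : ∀ v : V, {u | E u v ∨ E v u}.Finite)
    (hdeg : ∀ v : V, ({u | E u v ∨ E v u}).ncard ≤ Δ)
    (a : V → V → ℝ)
    (ha : ∀ u v : V, u ≠ v → ¬ (E u v ∨ E v u) → a u v = 0)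
    (A : lp (fun _ : V => ℝ) ∞ →L[ℝ] lp (fun _ : V => ℝ) ∞)
    (hA : ∀ (f : lp (fun _ : V => ℝ) ∞) (u : V), A f u = ∑' v, a u v * f v)
    (hneg : ∀ u v : V, u ≠ v → a u v ≤ 0)
    (hcol : ∀ v : V, ∑' u, a u v = 0) :
    ∀ f : V → ℝ, Summable (fun v => |f v|) →
      Summable (fun u => |∑' v, a u v * f v|) ∧
      ∑' u, |∑' v, a u v * f v| ≤ 2 * ‖A‖ * ∑' v, |f v| := by
  have hcolSum : ∀ v, HasSum (fun u => a u v) 0 := fun v => by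
    have hsupp : (Function.support fun u => a u v).Finite := by
      refine ((hfin v).insert v).subset fun u hu => ?_
      by_contra hn
      rw [Set.mem_insert_iff, not_or] at hn
      exact hu (ha u v hn.1 hn.2)
    exact hcol v ▸ (summable_of_hasFiniteSupport hsupp).hasSum
  have habs : ∀ v, HasSum (fun u => |a u v|) (2 * a v v) := fun v =>
    hasSum_abs_of_nonpos_off_diag (hcolSum v) fun u hu => hneg u v hu
  intro f hf
  refine l1_bound_of_column_bound (fun v => (habs v).summable) (fun v => ?_) hf
  rw [(habs v).tsum_eq]
  exact mul_le_mul_of_nonneg_left (diag_le_opNorm hA v) zero_le_two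
end

section
/- Second part of the ℓ¹-boundedness lemma (Lemma 2.6): Under the matrix-operator hypotheses, assume a u v ≤ 0 for all u ≠ v and ∑_u a u v = 0 for every v (a finite sum). Then for every f : V → ℝ in ℓ¹ and every integer k ≥ 1, the k-fold iterate A^k f of the matrix action (which stays in ℓ¹) satisfies ∑'_u (A^k f)(u) = 0. -/
open scoped ENNReal

/-- The matrix action `f ↦ (u ↦ ∑' v, a u v * f v)` of an infinite matrix `a`. -/
noncomputable def matAction {V : Type*} (a : V → V → ℝ) (f : V → ℝ) : V → ℝ :=
  fun u => ∑' v, a u v * f v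

/-- If the columns of `a` are bounded in `ℓ¹`, then the family `a u v * f v` is absolutely
summable over all pairs `(v, u)` for every `f` in `ℓ¹`. -/
theorem summable_abs_prod_of_column_bound {V : Type*} {a : V → V → ℝ} {C : ℝ}
    (hs : ∀ v, Summable fun u => |a u v|) (hC : ∀ v, ∑' u, |a u v| ≤ C)
    {f : V → ℝ} (hf : Summable fun v => |f v|) :
    Summable fun p : V × V => |a p.2 p.1 * f p.1| := by
  rw [summable_prod_of_nonneg (fun _ => abs_nonneg _)]
  simp only [abs_mul]
  refine ⟨fun v => (hs v).mul_right _, ?_⟩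
  simp only [tsum_mul_right]
  exact Summable.of_nonneg_of_le
    (fun v => mul_nonneg (tsum_nonneg fun _ => abs_nonneg _) (abs_nonneg _))
    (fun v => mul_le_mul_of_nonneg_right (hC v) (abs_nonneg _)) (hf.mul_left C)

/-- A matrix with columns bounded in `ℓ¹` maps `ℓ¹` to `ℓ¹`. -/
theorem summable_abs_matAction {V : Type*} {a : V → V → ℝ} {C : ℝ}
    (hs : ∀ v, Summable fun u => |a u v|) (hC : ∀ v, ∑' u, |a u v| ≤ C)
    {f : V → ℝ} (hf : Summable fun v => |f v|) :
    Summable fun u => |matAction a f u| := by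
  have h := (summable_abs_prod_of_column_bound hs hC hf).of_abs.prod_symm
  exact h.prod.abs

/-- The total sum of the image of an `ℓ¹` function is computed from the column sums. -/
theorem tsum_matAction {V : Type*} {a : V → V → ℝ} {C : ℝ}
    (hs : ∀ v, Summable fun u => |a u v|) (hC : ∀ v, ∑' u, |a u v| ≤ C)
    {f : V → ℝ} (hf : Summable fun v => |f v|) :
    ∑' u, matAction a f u = ∑' v, (∑' u, a u v) * f v := by
  have h := (summable_abs_prod_of_column_bound hs hC hf).of_abs
  simp only [← tsum_mul_right]
  exact Summable.tsum_comm (f := fun v u => a u v * f v) h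

/-- The diagonal entries of the matrix of a bounded operator on `ℓ∞` are bounded by its norm. -/
theorem abs_diag_le_opNorm {V : Type*} {a : V → V → ℝ}
    (A : lp (fun _ : V => ℝ) ∞ →L[ℝ] lp (fun _ : V => ℝ) ∞)
    (hA : ∀ (f : lp (fun _ : V => ℝ) ∞) (u : V), A f u = ∑' v, a u v * f v) (v : V) :
    |a v v| ≤ ‖A‖ := by
  classical
  set e : lp (fun _ : V => ℝ) ∞ := lp.single ∞ v (1 : ℝ) with he
  have hn : ‖e‖ = 1 := by
    rw [he, lp.norm_single (by simp)]
    simp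
  have hv : A e v = a v v := by
    rw [hA, tsum_eq_single v]
    · simp [he]
    · intro w hw
      simp [he, hw]
  calc |a v v| = ‖A e v‖ := by rw [hv, Real.norm_eq_abs]
    _ ≤ ‖A e‖ := lp.norm_apply_le_norm ENNReal.top_ne_zero _ _
    _ ≤ ‖A‖ * ‖e‖ := A.le_opNorm e
    _ = ‖A‖ := by rw [hn, mul_one]

/-- A summable column with nonpositive off-diagonal entries and vanishing sum has `ℓ¹` norm
at most twice its diagonal entry. -/
theorem tsum_abs_le_of_tsum_eq_zero {V : Type*} {c : V → ℝ} {v : V} (hs : Summable c)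
    (hneg : ∀ u, u ≠ v → c u ≤ 0) (hsum : ∑' u, c u = 0) :
    ∑' u, |c u| ≤ 2 * |c v| := by
  classical
  have h := (hasSum_ite_eq v (2 * |c v|)).sub hs.hasSum
  rw [hsum, sub_zero] at h
  refine hasSum_le (fun u => ?_) hs.abs.hasSum h
  split_ifs with huv
  · subst huv
    linarith [le_abs_self (c u)]
  · rw [abs_of_nonpos (hneg u huv), zero_sub]

/-- Second part of the ℓ¹-boundedness lemma (Lemma 2.6): under the matrix-operator
hypotheses, if the off-diagonal entries are nonpositive and every column sums to zero,
then for any ℓ¹ function `f` and any `k ≥ 1` the iterate `A^k f` stays in ℓ¹ and its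
total sum vanishes. -/
theorem l1_iterate_sum_zero
    {V : Type*} [Countable V]
    (E : V → V → Prop) (Δ : ℕ)
    (hfin : ∀ v : V, {u | E u v ∨ E v u}.Finite)
    (hdeg : ∀ v : V, ({u | E u v ∨ E v u}).ncard ≤ Δ)
    (a : V → V → ℝ)
    (ha : ∀ u v : V, u ≠ v → ¬ (E u v ∨ E v u) → a u v = 0)
    (A : lp (fun _ : V => ℝ) ∞ →L[ℝ] lp (fun _ : V => ℝ) ∞)
    (hA : ∀ (f : lp (fun _ : V => ℝ) ∞) (u : V), A f u = ∑' v, a u v * f v)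
    (hneg : ∀ u v : V, u ≠ v → a u v ≤ 0)
    (hcol : ∀ v : V, ∑' u, a u v = 0) :
    ∀ f : V → ℝ, Summable (fun v => |f v|) →
      ∀ k : ℕ, 1 ≤ k →
        Summable (fun u => |(matAction a)^[k] f u|) ∧
        ∑' u, (matAction a)^[k] f u = 0 := by
  have hsum (v : V) : Summable fun u => a u v := by
    refine summable_of_hasFiniteSupport (((hfin v).insert v).subset fun u hu => ?_)
    by_contra h
    rw [Set.mem_insert_iff, not_or] at h
    exact hu (ha u v h.1 h.2)
  have hs (v : V) : Summable fun u => |a u v| := (hsum v).abs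
  have hC (v : V) : ∑' u, |a u v| ≤ 2 * ‖A‖ :=
    (tsum_abs_le_of_tsum_eq_zero (hsum v) (fun u hu => hneg u v hu) (hcol v)).trans
      (mul_le_mul_of_nonneg_left (abs_diag_le_opNorm A hA v) zero_le_two)
  intro f hf k hk
  have hl (n : ℕ) : Summable fun u => |(matAction a)^[n] f u| := by
    induction n with
    | zero => exact hf
    | succ n ih =>
      simp only [Function.iterate_succ_apply']
      exact summable_abs_matAction hs hC ih
  refine ⟨hl k, ?_⟩
  obtain ⟨n, rfl⟩ := Nat.exists_eq_add_of_le' hk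
  rw [Function.iterate_succ_apply', tsum_matAction hs hC (hl n)]
  simp [hcol]
end

section
/- Stability proposition (Proposition 2.7): Let n be a nonempty finite type and M : Matrix n n ℝ a real square matrix such that M u v ≤ 0 for all u ≠ v and ∑_u M u v = 0 for every column index v. Then every eigenvalue μ ∈ ℂ of M (i.e., every element of the spectrum of the complex matrix obtained by mapping the entries of M into ℂ) satisfies Re μ ≥ 0; equivalently, −M is semistable. -/
/-- Stability proposition (Proposition 2.7): a real square matrix with nonpositive
off-diagonal entries and zero column sums has all complex eigenvalues with
nonnegative real part (equivalently, `-M` is semistable). -/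
theorem singular_M_matrix_semistable
    {n : Type*} [Fintype n] [Nonempty n] [DecidableEq n]
    (M : Matrix n n ℝ)
    (hoff : ∀ u v : n, u ≠ v → M u v ≤ 0)
    (hcol : ∀ v : n, ∑ u, M u v = 0)
    (μ : ℂ) (hμ : μ ∈ spectrum ℂ (M.map (Complex.ofReal : ℝ → ℂ))) :
    0 ≤ μ.re := by
  by_contra! hre
  refine hμ ?_
  rw [spectrum.mem_resolventSet_iff, Matrix.isUnit_iff_isUnit_det, isUnit_iff_ne_zero]
  refine det_ne_zero_of_sum_col_lt_diag fun k => ?_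
  have hsum : ∑ i ∈ Finset.univ.erase k,
      ‖(algebraMap ℂ (Matrix n n ℂ) μ - M.map (Complex.ofReal : ℝ → ℂ)) i k‖ = M k k := by
    have hnorm : ∀ i ∈ Finset.univ.erase k,
        ‖(algebraMap ℂ (Matrix n n ℂ) μ - M.map (Complex.ofReal : ℝ → ℂ)) i k‖ = -M i k := by
      intro i hi
      have hik := Finset.ne_of_mem_erase hi
      simp [Matrix.algebraMap_matrix_apply, hik, abs_of_nonpos (hoff i k hik)]
    rw [Finset.sum_congr rfl hnorm, Finset.sum_neg_distrib]
    linarith [Finset.add_sum_erase Finset.univ (fun i => M i k) (Finset.mem_univ k), hcol k]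
  rw [hsum]
  have hdiag : (algebraMap ℂ (Matrix n n ℂ) μ - M.map (Complex.ofReal : ℝ → ℂ)) k k
      = μ - (M k k : ℂ) := by
    simp [Matrix.algebraMap_matrix_apply]
  rw [hdiag]
  have hle := (neg_le_abs _).trans (Complex.abs_re_le_norm (μ - (M k k : ℂ)))
  rw [Complex.sub_re, Complex.ofReal_re] at hle
  linarith
end

section
/- Displacement lemma (Lemma 2.13): Under the matrix-operator hypotheses and the oriented-tree hypotheses, assume: a u v ≤ 0 for all u ≠ v; ∑_u a u v = 0 for every v; a u v = 0 unless u = v or E v u; and ∑_{u ∈ N⁺(v)} d(v,u) · a u v = −1 for every v. Fix a vertex v, write d̄_v(g) = ∑'_u (φ(u) − φ(v)) · g(u), and let ℱ be the set of f : V → ℝ in ℓ¹ whose support is contained in N⁺∞[v] and with d̄_v(|f|) < ∞. Then there exists β ≥ 1 such that for every f ∈ ℱ and every k ≥ 0, the iterated matrix action A^k f belongs to ℱ and d̄_v(|A^k f|) ≤ β^k · (k·‖f‖₁ + d̄_v(|f|)). Moreover d̄_v(A f) = −∑'_w f(w) and d̄_v(A^k f) = 0 for every k ≥ 2. -/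
open scoped ENNReal

/-- Fubini for the matrix action against a weight `q`: if the weighted column sums are dominated by
a summable function, then the weighted action is absolutely summable and the order of summation
can be exchanged. -/
theorem matAction_weighted_sum {V : Type*} {a : V → V → ℝ} {q f B : V → ℝ}
    (hcol : ∀ w, (Function.support fun u => a u w).Finite) (hB : Summable B)
    (hle : ∀ w, ∑' u, |q u * (a u w * f w)| ≤ B w) :
    Summable (fun u => |q u * matAction a f u|) ∧
      ∑' u, |q u * matAction a f u| ≤ ∑' w, B w ∧
      ∑' u, q u * matAction a f u = ∑' w, (∑' u, q u * a u w) * f w := by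
  set F : V × V → ℝ := fun x => q x.2 * (a x.2 x.1 * f x.1) with hF
  have hcolF : ∀ w, Summable fun u => |F (w, u)| := fun w => by
    refine summable_of_hasFiniteSupport ((hcol w).subset fun u hu h => hu ?_)
    simp [hF, h]
  have habs : Summable fun x => |F x| :=
    (summable_prod_of_nonneg fun x => abs_nonneg (F x)).2
      ⟨hcolF, hB.of_nonneg_of_le (fun w => tsum_nonneg fun u => abs_nonneg _) hle⟩
  have hsum : Summable F := habs.of_abs
  have hrow : ∀ u, q u * matAction a f u = ∑' w, F (w, u) := fun u =>
    tsum_mul_left.symm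
  have habs' : Summable fun x : V × V => |F x.swap| := habs.prod_symm
  have hrowle : ∀ u, |q u * matAction a f u| ≤ ∑' w, |F (w, u)| := fun u => by
    rw [hrow]
    exact norm_tsum_le_tsum_norm (f := fun w => F (w, u)) (habs'.prod_factor u)
  have hrows : Summable fun u => ∑' w, |F (w, u)| := habs'.prod
  have hfirst := hrows.of_nonneg_of_le (fun u => abs_nonneg _) hrowle
  refine ⟨hfirst, (hfirst.tsum_le_tsum hrowle hrows).trans ?_, ?_⟩
  · rw [Summable.tsum_comm (f := fun w u => |F (w, u)|) habs]
    exact habs.prod.tsum_le_tsum hle hB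
  · simp_rw [hrow]
    rw [Summable.tsum_comm (f := fun w u => F (w, u)) hsum]
    refine tsum_congr fun w => ?_
    rw [← tsum_mul_right]
    exact tsum_congr fun u => (mul_assoc _ _ _).symm

/-- Displacement lemma (Lemma 2.13): on an oriented tree, under the matrix-operator
hypotheses, Mass Transfer, Advection I and the unit-speed condition, the average
displacement of the iterates `A^k f` from a fixed vertex `v` satisfies the stated
bounds, and equals `-∑' w, f w` for `k = 1` and `0` for `k ≥ 2`. -/
theorem displacement_lemma
    {V : Type*} [Countable V]
    (E : V → V → Prop) (Δ : ℕ)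
    (hfin : ∀ v : V, {u | E u v ∨ E v u}.Finite)
    (hdeg : ∀ v : V, ({u | E u v ∨ E v u}).ncard ≤ Δ)
    (a : V → V → ℝ)
    (ha : ∀ u v : V, u ≠ v → ¬ (E u v ∨ E v u) → a u v = 0)
    (A : lp (fun _ : V => ℝ) ∞ →L[ℝ] lp (fun _ : V => ℝ) ∞)
    (hA : ∀ (f : lp (fun _ : V => ℝ) ∞) (u : V), A f u = ∑' v, a u v * f v)
    -- oriented-tree hypotheses
    (hnobi : ∀ u v : V, E u v → ¬ E v u)
    (hconn : (SimpleGraph.fromRel E).Connected)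
    (hacyc : (SimpleGraph.fromRel E).IsAcyclic)
    (ω : V → V → ℝ) (δ : ℝ) (hδ : 0 < δ)
    (hω : ∀ v u : V, E v u → δ ≤ ω v u)
    (φ : V → ℝ) (hφ : ∀ v u : V, E v u → φ u - φ v = ω v u)
    -- Mass Transfer, Advection I and unit speed
    (hneg : ∀ u v : V, u ≠ v → a u v ≤ 0)
    (hcol : ∀ v : V, ∑' u, a u v = 0)
    (hfwd : ∀ u v : V, u ≠ v → ¬ E v u → a u v = 0)
    (hspeed : ∀ v : V, ∑' u : {u : V // E v u}, (φ (u : V) - φ v) * a (u : V) v = -1)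
    -- fixed vertex
    (v : V) :
    ∃ β : ℝ, 1 ≤ β ∧
      ∀ f : V → ℝ,
        Summable (fun w => |f w|) →
        (∀ w : V, ¬ Relation.ReflTransGen E v w → f w = 0) →
        Summable (fun w => (φ w - φ v) * |f w|) →
        (∀ k : ℕ,
          (Summable (fun w => |(matAction a)^[k] f w|) ∧
            (∀ w : V, ¬ Relation.ReflTransGen E v w → (matAction a)^[k] f w = 0) ∧
            Summable (fun w => (φ w - φ v) * |(matAction a)^[k] f w|)) ∧
          ∑' w, (φ w - φ v) * |(matAction a)^[k] f w| ≤
            β ^ k * (k * (∑' w, |f w|) + ∑' w, (φ w - φ v) * |f w|)) ∧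
        (∑' w, (φ w - φ v) * matAction a f w = - ∑' w, f w) ∧
        (∀ k : ℕ, 2 ≤ k → ∑' w, (φ w - φ v) * (matAction a)^[k] f w = 0) := by
  classical
  have hloop : ∀ w, ¬ E w w := fun w h => hnobi w w h h
  have hN : ∀ w, {u | E w u}.Finite := fun w => (hfin w).subset fun u hu => Or.inr hu
  set N : V → Finset V := fun w => (hN w).toFinset with hNdef
  have memN : ∀ {w u}, u ∈ N w ↔ E w u := by simp [hNdef]
  have hnotin : ∀ w, w ∉ N w := fun w h => hloop w (memN.1 h)
  have hzero : ∀ w u, u ∉ insert w (N w) → a u w = 0 := fun w u hu => by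
    rw [Finset.mem_insert, not_or] at hu
    exact hfwd u w hu.1 fun h => hu.2 (memN.2 h)
  have hcolfin : ∀ w, (Function.support fun u => a u w).Finite := fun w =>
    (insert w (N w)).finite_toSet.subset fun u hu => by
      by_contra h
      exact hu (hzero w u h)
  have htsum : ∀ (w : V) (g : V → ℝ), (∀ u, a u w = 0 → g u = 0) →
      ∑' u, g u = g w + ∑ u ∈ N w, g u := fun w g hg => by
    rw [tsum_eq_sum (s := insert w (N w)) fun u hu => hg u (hzero w u hu),
      Finset.sum_insert (hnotin w)]
  have hdiag : ∀ w, a w w = ∑ u ∈ N w, -a u w := fun w => by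
    have h := hcol w
    rw [htsum w _ fun u h => h] at h
    rw [Finset.sum_neg_distrib]
    linarith
  have hoff : ∀ w, ∀ u ∈ N w, a u w ≤ 0 := fun w u hu =>
    hneg u w fun h => hnotin w (h ▸ hu)
  have hunit : ∀ w, ∑ u ∈ N w, (φ u - φ w) * a u w = -1 := fun w => by
    rw [← hspeed w]
    have : ∑' u : {u : V // E w u}, (φ (u : V) - φ w) * a (u : V) w
        = ∑' u : {u : V // u ∈ N w}, (φ (u : V) - φ w) * a (u : V) w :=
      ((Equiv.subtypeEquivRight fun u => memN).tsum_eq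
        fun u : {u : V // E w u} => (φ (u : V) - φ w) * a (u : V) w).symm
    rw [this, Finset.tsum_subtype (N w) fun u => (φ u - φ w) * a u w]
  have hφE : ∀ {w u}, E w u → δ ≤ φ u - φ w := fun {w u} h => (hφ w u h).symm ▸ hω w u h
  have hdiag_nonneg : ∀ w, 0 ≤ a w w := fun w => by
    rw [hdiag]
    exact Finset.sum_nonneg fun u hu => neg_nonneg.2 (hoff w u hu)
  have hdiag_le : ∀ w, δ * a w w ≤ 1 := fun w => by
    have : ∑ u ∈ N w, δ * -a u w ≤ ∑ u ∈ N w, (φ u - φ w) * -a u w :=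
      Finset.sum_le_sum fun u hu =>
        mul_le_mul_of_nonneg_right (hφE (memN.1 hu)) (neg_nonneg.2 (hoff w u hu))
    rw [hdiag, Finset.mul_sum]
    refine this.trans_eq ?_
    simp_rw [mul_neg, Finset.sum_neg_distrib, hunit, neg_neg]
  set p : V → ℝ := fun w => φ w - φ v with hp
  have hp_nonneg : ∀ w, Relation.ReflTransGen E v w → 0 ≤ p w := fun w h => by
    induction h with
    | refl => simp [hp]
    | tail _ h ih =>
      have := hφE h
      simp only [hp] at ih ⊢
      linarith
  set β : ℝ := max 1 (2 / δ) with hβ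
  have hβ1 : 1 ≤ β := le_max_left _ _
  have hβdiag : ∀ w, 2 * a w w ≤ β := fun w => by
    refine le_trans ?_ (le_max_right _ _)
    rw [le_div_iff₀ hδ]
    linarith [hdiag_le w]
  have hcolabs : ∀ (w : V) (x : ℝ), ∑' u, |(1 : ℝ) * (a u w * x)| ≤ β * |x| := fun w x => by
    rw [htsum w _ fun u h => by simp [h]]
    have : ∑ u ∈ N w, |(1 : ℝ) * (a u w * x)| = a w w * |x| := by
      rw [hdiag, Finset.sum_mul]
      refine Finset.sum_congr rfl fun u hu => ?_
      rw [one_mul, abs_mul, abs_of_nonpos (hoff w u hu)]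
    rw [this, one_mul, abs_mul, abs_of_nonneg (hdiag_nonneg w)]
    nlinarith [hβdiag w, abs_nonneg x]
  have hcolp : ∀ (w : V) (x : ℝ), (¬ Relation.ReflTransGen E v w → x = 0) →
      ∑' u, |p u * (a u w * x)| ≤ β * (p w * |x|) + |x| := fun w x hx => by
    by_cases hw : Relation.ReflTransGen E v w
    · have hpw := hp_nonneg w hw
      rw [htsum w _ fun u h => by simp [h]]
      have : ∑ u ∈ N w, |p u * (a u w * x)| = (p w * a w w + 1) * |x| := by
        have h1 : (1 : ℝ) = ∑ u ∈ N w, (φ u - φ w) * -a u w := by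
          simp_rw [mul_neg, Finset.sum_neg_distrib, hunit, neg_neg]
        rw [h1, hdiag, Finset.mul_sum, ← Finset.sum_add_distrib, Finset.sum_mul]
        refine Finset.sum_congr rfl fun u hu => ?_
        rw [abs_mul, abs_mul, abs_of_nonneg (hp_nonneg u (hw.tail (memN.1 hu))),
          abs_of_nonpos (hoff w u hu)]
        simp only [hp]
        ring
      rw [this, abs_mul, abs_mul, abs_of_nonneg hpw, abs_of_nonneg (hdiag_nonneg w)]
      nlinarith [mul_le_mul_of_nonneg_right (hβdiag w) (mul_nonneg hpw (abs_nonneg x))]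
    · simp [hx hw]
  have hcolp_sum : ∀ w, ∑' u, p u * a u w = -1 := fun w => by
    rw [htsum w _ fun u h => by simp [h]]
    have h1 : ∑ u ∈ N w, p u * a u w
        = ∑ u ∈ N w, (φ u - φ w) * a u w - p w * ∑ u ∈ N w, -a u w := by
      rw [Finset.mul_sum, ← Finset.sum_sub_distrib]
      refine Finset.sum_congr rfl fun u _ => ?_
      simp only [hp]
      ring
    rw [h1, hunit, ← hdiag]
    ring
  have hsupp : ∀ f : V → ℝ, (∀ w, ¬ Relation.ReflTransGen E v w → f w = 0) →
      ∀ w, ¬ Relation.ReflTransGen E v w → matAction a f w = 0 := fun f hf u hu => by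
    have : ∀ w, a u w * f w = 0 := fun w => by
      by_cases hw : Relation.ReflTransGen E v w
      · rw [hfwd u w (fun h => hu (h ▸ hw)) fun h => hu (hw.tail h), zero_mul]
      · rw [hf w hw, mul_zero]
    simp [matAction, this]
  have habsp : ∀ g : V → ℝ, (∀ w, ¬ Relation.ReflTransGen E v w → g w = 0) →
      (fun w => |p w * g w|) = fun w => p w * |g w| := fun g hg => by
    funext w
    by_cases hw : Relation.ReflTransGen E v w
    · rw [abs_mul, abs_of_nonneg (hp_nonneg w hw)]
    · simp [hg w hw]
  have hone : ∀ f : V → ℝ, Summable (fun w => |f w|) →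
      Summable (fun w => |matAction a f w|) ∧
        ∑' w, |matAction a f w| ≤ β * ∑' w, |f w| ∧ ∑' w, matAction a f w = 0 := fun f hf => by
    have h := matAction_weighted_sum (q := fun _ => 1) (f := f) hcolfin (hf.mul_left β)
      fun w => hcolabs w (f w)
    simp only [one_mul, hcol, zero_mul, tsum_zero, tsum_mul_left] at h
    exact h
  have hdisp : ∀ f : V → ℝ, Summable (fun w => |f w|) →
      (∀ w, ¬ Relation.ReflTransGen E v w → f w = 0) → Summable (fun w => p w * |f w|) →
      Summable (fun w => p w * |matAction a f w|) ∧
        ∑' w, p w * |matAction a f w| ≤ β * ∑' w, p w * |f w| + ∑' w, |f w| ∧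
        ∑' w, p w * matAction a f w = - ∑' w, f w := fun f hf hfs hfp => by
    have h := matAction_weighted_sum (q := p) (f := f) hcolfin ((hfp.mul_left β).add hf)
      fun w => hcolp w (f w) (hfs w)
    rw [habsp _ (hsupp f hfs), (hfp.mul_left β).tsum_add hf, tsum_mul_left] at h
    simp only [hcolp_sum, neg_one_mul, tsum_neg] at h
    exact h
  refine ⟨β, hβ1, fun f hf hfs hfp => ?_⟩
  have hiter : ∀ k : ℕ,
      (Summable (fun w => |(matAction a)^[k] f w|) ∧
        (∀ w : V, ¬ Relation.ReflTransGen E v w → (matAction a)^[k] f w = 0) ∧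
        Summable (fun w => p w * |(matAction a)^[k] f w|)) ∧
      ∑' w, |(matAction a)^[k] f w| ≤ β ^ k * ∑' w, |f w| ∧
      ∑' w, p w * |(matAction a)^[k] f w| ≤
        β ^ k * (k * (∑' w, |f w|) + ∑' w, p w * |f w|) := fun k => by
    induction k with
    | zero => exact ⟨⟨hf, hfs, hfp⟩, by simp, by simp⟩
    | succ k ih =>
      obtain ⟨⟨h1, h2, h3⟩, h4, h5⟩ := ih
      obtain ⟨s1, s2, -⟩ := hone _ h1
      obtain ⟨d1, d2, -⟩ := hdisp _ h1 h2 h3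
      simp only [Function.iterate_succ_apply']
      have hβ0 : 0 ≤ β := zero_le_one.trans hβ1
      have hn : 0 ≤ β ^ k * ∑' w, |f w| :=
        mul_nonneg (pow_nonneg hβ0 k) (tsum_nonneg fun w => abs_nonneg _)
      refine ⟨⟨s1, hsupp _ h2, d1⟩, ?_, ?_⟩
      · refine s2.trans ((mul_le_mul_of_nonneg_left h4 hβ0).trans_eq ?_)
        ring
      · have h6 := mul_le_mul_of_nonneg_left h5 hβ0
        have h7 := mul_le_mul_of_nonneg_right hβ1 hn
        have h8 : β ^ (k + 1) * (((k + 1 : ℕ) : ℝ) * (∑' w, |f w|) + ∑' w, p w * |f w|)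
            = β * (β ^ k * (k * (∑' w, |f w|) + ∑' w, p w * |f w|))
              + β * (β ^ k * ∑' w, |f w|) := by
          push_cast
          ring
        rw [h8]
        linarith
  refine ⟨fun k => ⟨(hiter k).1, (hiter k).2.2⟩, (hdisp f hf hfs hfp).2.2, fun k hk => ?_⟩
  obtain ⟨m, rfl⟩ := Nat.exists_eq_add_of_le' hk
  obtain ⟨⟨h1, h2, h3⟩, -⟩ := hiter (m + 1)
  have h := (hdisp _ h1 h2 h3).2.2
  rw [show m + 2 = m + 1 + 1 from rfl, Function.iterate_succ_apply']
  refine h.trans ?_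
  rw [Function.iterate_succ_apply', (hone _ (hiter m).1.1).2.2, neg_zero]
end

section
/- Layer-sum lemma (Lemma 2.15): Under the matrix-operator hypotheses and the oriented-tree hypotheses, assume a u v ≤ 0 for all u ≠ v, ∑_u a u v = 0 for every v, and a u v = 0 unless u = v or E v u. Fix a vertex u and define the layers N⁺_0(u) = {u} and N⁺_{i+1}(u) = ⋃_{w ∈ N⁺_i(u)} N⁺(w) (in an oriented tree these layers are pairwise disjoint). Let g : V → ℝ be a nonnegative function in ℓ¹ whose support is contained in {z : ∃ y, y is reachable from no one in particular but satisfies: u is reachable from y and z is reachable from y}. Then for every integer k ≥ 1 one has a u u · g(u) = −∑_{i=1}^{k} ∑_{w ∈ N⁺_i(u)} (A g)(w) + ∑_{w ∈ N⁺_k(u)} a w w · g(w), where all sums over layers converge absolutely. -/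
open scoped ENNReal

/-- The `i`-th out-layer of a vertex `u`: `N⁺_0(u) = {u}` and
`N⁺_{i+1}(u) = ⋃_{w ∈ N⁺_i(u)} N⁺(w)`. -/
def outLayer {V : Type*} (E : V → V → Prop) (u : V) : ℕ → Set V
  | 0 => {u}
  | (i + 1) => {z | ∃ w ∈ outLayer E u i, E w z}

/-- Following directed edges out of `y` to `x`, one either avoids the edge from `v` to `w`
or passes through `w`. -/
lemma reachable_deleteEdges_or_reflTransGen {V : Type*} {E : V → V → Prop}
    (hnobi : ∀ u v : V, E u v → ¬ E v u) (v w : V) {y x : V}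
    (h : Relation.ReflTransGen E y x) :
    ((SimpleGraph.fromRel E).deleteEdges {s(v, w)}).Reachable y x ∨
      (((SimpleGraph.fromRel E).deleteEdges {s(v, w)}).Reachable y v ∨ E w v) ∧
        (Relation.ReflTransGen E w x ∨ E w v) := by
  induction h with
  | refl => exact Or.inl (SimpleGraph.Reachable.refl _)
  | @tail b c _ hbc ih =>
    rcases ih with ih | ⟨h1, h2⟩
    · by_cases hs : s(b, c) = s(v, w)
      · rcases Sym2.eq_iff.mp hs with ⟨rfl, rfl⟩ | ⟨rfl, rfl⟩
        · exact Or.inr ⟨Or.inl ih, Or.inl .refl⟩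
        · exact Or.inr ⟨Or.inr hbc, Or.inr hbc⟩
      · refine Or.inl (ih.trans (SimpleGraph.Adj.reachable ?_))
        rw [SimpleGraph.deleteEdges_adj]
        refine ⟨?_, hs⟩
        rw [SimpleGraph.fromRel_adj]
        exact ⟨fun h => hnobi b c hbc (h ▸ h ▸ hbc), Or.inl hbc⟩
    · exact Or.inr ⟨h1, h2.imp_left fun h => h.tail hbc⟩

lemma not_reachable_deleteEdges {V : Type*} {E : V → V → Prop}
    (hnobi : ∀ u v : V, E u v → ¬ E v u) (hacyc : (SimpleGraph.fromRel E).IsAcyclic)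
    {v w : V} (h : E v w) :
    ¬ ((SimpleGraph.fromRel E).deleteEdges {s(v, w)}).Reachable v w := by
  have hadj : (SimpleGraph.fromRel E).Adj v w := by
    rw [SimpleGraph.fromRel_adj]
    exact ⟨fun e => hnobi v w h (e ▸ e ▸ h), Or.inl h⟩
  have := SimpleGraph.isAcyclic_iff_forall_adj_isBridge.mp hacyc hadj
  rwa [SimpleGraph.isBridge_iff] at this

/-- An oriented tree has no directed cycles. -/
lemma not_reflTransGen_of_edge {V : Type*} {E : V → V → Prop}
    (hnobi : ∀ u v : V, E u v → ¬ E v u) (hacyc : (SimpleGraph.fromRel E).IsAcyclic)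
    {v w : V} (h : E v w) : ¬ Relation.ReflTransGen E w v := by
  intro hwv
  have hno := not_reachable_deleteEdges hnobi hacyc h
  rcases reachable_deleteEdges_or_reflTransGen hnobi v w hwv with h1 | ⟨h1 | h1, -⟩
  · exact hno h1.symm
  · exact hno h1.symm
  · exact hnobi _ _ h h1

/-- In an oriented tree, two in-neighbors of a vertex with a common ancestor coincide. -/
lemma eq_of_edge_of_edge_of_reflTransGen {V : Type*} {E : V → V → Prop}
    (hnobi : ∀ u v : V, E u v → ¬ E v u) (hacyc : (SimpleGraph.fromRel E).IsAcyclic)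
    {y v v' w : V} (hv : Relation.ReflTransGen E y v) (hv' : Relation.ReflTransGen E y v')
    (h : E v w) (h' : E v' w) : v' = v := by
  by_contra hne
  have key : ∀ x, E x w → Relation.ReflTransGen E y x →
      ((SimpleGraph.fromRel E).deleteEdges {s(v, w)}).Reachable y x := by
    intro x hx hyx
    rcases reachable_deleteEdges_or_reflTransGen hnobi v w hyx with h1 | ⟨-, h1 | h1⟩
    · exact h1
    · exact absurd h1 (not_reflTransGen_of_edge hnobi hacyc hx)
    · exact absurd h1 (hnobi _ _ h)
  refine not_reachable_deleteEdges hnobi hacyc h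
    (((key v h hv).symm.trans (key v' h' hv')).trans (SimpleGraph.Adj.reachable ?_))
  have hvw : v' ≠ w := fun e => hnobi v' w h' (e ▸ e ▸ h')
  rw [SimpleGraph.deleteEdges_adj, SimpleGraph.fromRel_adj]
  refine ⟨⟨hvw, Or.inl h'⟩, fun hs => ?_⟩
  rcases Sym2.eq_iff.mp hs with ⟨e, -⟩ | ⟨e, -⟩
  · exact hne e
  · exact hvw e

lemma outLayer_finite {V : Type*} {E : V → V → Prop}
    (hfin : ∀ v : V, {u | E u v ∨ E v u}.Finite) (u : V) (i : ℕ) :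
    (outLayer E u i).Finite := by
  induction i with
  | zero => exact Set.finite_singleton u
  | succ i ih =>
    refine (ih.biUnion fun w _ => hfin w).subset ?_
    rintro z ⟨w, hw, hz⟩
    exact Set.mem_biUnion hw (Or.inr hz)

lemma reflTransGen_of_mem_outLayer {V : Type*} {E : V → V → Prop} {u : V} {i : ℕ} {z : V}
    (hz : z ∈ outLayer E u i) : Relation.ReflTransGen E u z := by
  induction i generalizing z with
  | zero => exact (show z = u from hz) ▸ .refl
  | succ i ih =>
    obtain ⟨w, hw, hwz⟩ := hz
    exact (ih hw).tail hwz

lemma Set.Finite.tsum_subtype_eq_sum {V : Type*} {s : Set V} (hs : s.Finite) (f : V → ℝ) :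
    ∑' w : s, f w = ∑ w ∈ hs.toFinset, f w := by
  rw [tsum_subtype s f, tsum_eq_sum (s := hs.toFinset)]
  · exact Finset.sum_congr rfl fun x hx => Set.indicator_of_mem (hs.mem_toFinset.mp hx) f
  · exact fun x hx => Set.indicator_of_notMem (fun h => hx (hs.mem_toFinset.mpr h)) f

/-- Consecutive layers: summing `A g` over a layer gives the difference of the diagonal sums
over this layer and the previous one. -/
lemma sum_matAction_outLayer_succ {V : Type*} {E : V → V → Prop}
    (hfin : ∀ v : V, {u | E u v ∨ E v u}.Finite) {a : V → V → ℝ}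
    (hnobi : ∀ u v : V, E u v → ¬ E v u) (hacyc : (SimpleGraph.fromRel E).IsAcyclic)
    (hcol : ∀ v : V, ∑' u, a u v = 0)
    (hfwd : ∀ u v : V, u ≠ v → ¬ E v u → a u v = 0) {u : V} {g : V → ℝ}
    (hgsupp : ∀ z : V,
      (¬ ∃ y : V, Relation.ReflTransGen E y u ∧ Relation.ReflTransGen E y z) → g z = 0)
    (i : ℕ) :
    ∑ w ∈ (outLayer_finite hfin u (i + 1)).toFinset, matAction a g w =
      ∑ w ∈ (outLayer_finite hfin u (i + 1)).toFinset, a w w * g w -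
        ∑ w ∈ (outLayer_finite hfin u i).toFinset, a w w * g w := by
  classical
  set S := (outLayer_finite hfin u i).toFinset with hS
  set T := (outLayer_finite hfin u (i + 1)).toFinset with hT
  set b : V → V → ℝ := fun w v => if E v w then a w v else 0 with hb
  have hirr : ∀ v, ¬ E v v := fun v h => hnobi v v h h
  have hab : ∀ w v, a w v = (if v = w then a w w else 0) + b w v := by
    intro w v
    by_cases hvw : v = w
    · subst hvw; simp [hb, hirr]
    · by_cases hE : E v w
      · simp [hb, hvw, hE]
      · simp [hb, hvw, hE, hfwd w v (Ne.symm hvw) hE]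
  have hrow : ∀ w ∈ T, matAction a g w = a w w * g w + ∑ v ∈ S, b w v * g v := by
    intro w hw
    obtain ⟨p, hp, hpw⟩ := (outLayer_finite hfin u (i + 1)).mem_toFinset.mp hw
    have hzero : ∀ v ∉ S, b w v * g v = 0 := by
      intro v hv
      by_cases hE : E v w
      · rw [hgsupp v, mul_zero]
        rintro ⟨y, hyu, hyv⟩
        refine hv ((outLayer_finite hfin u i).mem_toFinset.mpr ?_)
        rw [eq_of_edge_of_edge_of_reflTransGen hnobi hacyc
          (hyu.trans (reflTransGen_of_mem_outLayer hp)) hyv hpw hE]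
        exact hp
      · simp [hb, hE]
    have h1 : HasSum (fun v => b w v * g v) (∑ v ∈ S, b w v * g v) :=
      hasSum_sum_of_ne_finset_zero hzero
    have h2 : HasSum (fun v => if v = w then a w w * g w else 0) (a w w * g w) :=
      hasSum_ite_eq w _
    rw [matAction, ← (h2.add h1).tsum_eq]
    refine tsum_congr fun v => ?_
    rw [hab w v, add_mul]
    by_cases hvw : v = w
    · subst hvw; simp
    · simp [hvw]
  have hcolsum : ∀ v ∈ S, ∑ w ∈ T, b w v = - a v v := by
    intro v hv
    have h1 : HasSum (fun w => b w v) (∑ w ∈ T, b w v) := by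
      refine hasSum_sum_of_ne_finset_zero fun w hw => ?_
      refine if_neg fun hE => hw ((outLayer_finite hfin u (i + 1)).mem_toFinset.mpr ?_)
      exact ⟨v, (outLayer_finite hfin u i).mem_toFinset.mp hv, hE⟩
    have h2 : HasSum (fun w => if w = v then a v v else 0) (a v v) := hasSum_ite_eq v _
    have h3 := (h2.add h1).tsum_eq
    have h4 : ∑' w, a w v = ∑' w, ((if w = v then a v v else 0) + b w v) := by
      refine tsum_congr fun w => ?_
      rw [hab w v]
      by_cases hvw : w = v
      · subst hvw; simp
      · simp [hvw, Ne.symm hvw]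
    linarith [hcol v]
  rw [Finset.sum_congr rfl hrow, Finset.sum_add_distrib, Finset.sum_comm, sub_eq_add_neg,
    ← Finset.sum_neg_distrib]
  congr 1
  refine Finset.sum_congr rfl fun v hv => ?_
  rw [← Finset.sum_mul, hcolsum v hv, neg_mul]

/-- Layer-sum lemma (Lemma 2.15): on an oriented tree, under the matrix-operator
hypotheses, Mass Transfer and Advection I, for a nonnegative ℓ¹ function `g` supported
on the successor cone of the predecessor cone of `u` one has, for every `k ≥ 1`,
`a u u * g u = -∑_{i=1}^k ∑_{w ∈ N⁺_i(u)} (A g)(w) + ∑_{w ∈ N⁺_k(u)} a w w * g w`,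
all layer sums converging absolutely. -/
theorem layer_sum_lemma
    {V : Type*} [Countable V]
    (E : V → V → Prop) (Δ : ℕ)
    (hfin : ∀ v : V, {u | E u v ∨ E v u}.Finite)
    (hdeg : ∀ v : V, ({u | E u v ∨ E v u}).ncard ≤ Δ)
    (a : V → V → ℝ)
    (ha : ∀ u v : V, u ≠ v → ¬ (E u v ∨ E v u) → a u v = 0)
    (A : lp (fun _ : V => ℝ) ∞ →L[ℝ] lp (fun _ : V => ℝ) ∞)
    (hA : ∀ (f : lp (fun _ : V => ℝ) ∞) (u : V), A f u = ∑' v, a u v * f v)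
    -- oriented-tree hypotheses
    (hnobi : ∀ u v : V, E u v → ¬ E v u)
    (hconn : (SimpleGraph.fromRel E).Connected)
    (hacyc : (SimpleGraph.fromRel E).IsAcyclic)
    -- Mass Transfer and Advection I
    (hneg : ∀ u v : V, u ≠ v → a u v ≤ 0)
    (hcol : ∀ v : V, ∑' u, a u v = 0)
    (hfwd : ∀ u v : V, u ≠ v → ¬ E v u → a u v = 0)
    -- vertex and function
    (u : V) (g : V → ℝ)
    (hgpos : ∀ z, 0 ≤ g z) (hgl1 : Summable (fun z => |g z|))
    (hgsupp : ∀ z : V,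
      (¬ ∃ y : V, Relation.ReflTransGen E y u ∧ Relation.ReflTransGen E y z) → g z = 0) :
    ∀ k : ℕ, 1 ≤ k →
      (∀ i : ℕ, Summable (fun w : outLayer E u i => |matAction a g (w : V)|)) ∧
      (∀ i : ℕ, Summable (fun w : outLayer E u i => |a (w : V) (w : V) * g (w : V)|)) ∧
      a u u * g u =
        -(∑ i ∈ Finset.Icc 1 k, ∑' w : outLayer E u i, matAction a g (w : V)) +
          ∑' w : outLayer E u k, a (w : V) (w : V) * g (w : V) := by
  intro k _
  refine ⟨fun i => ?_, fun i => ?_, ?_⟩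
  · have := (outLayer_finite hfin u i).to_subtype
    exact Summable.of_finite
  · have := (outLayer_finite hfin u i).to_subtype
    exact Summable.of_finite
  rw [(outLayer_finite hfin u k).tsum_subtype_eq_sum fun w => a w w * g w,
    Finset.sum_congr rfl fun i _ =>
      (outLayer_finite hfin u i).tsum_subtype_eq_sum (matAction a g)]
  clear * - hnobi hacyc hcol hfwd hgsupp
  induction k with
  | zero =>
    have h0 : (outLayer_finite hfin u 0).toFinset = {u} := by
      ext z
      simp [outLayer]
    simp [h0]
  | succ k ih =>
    rw [Finset.sum_Icc_succ_top (by omega),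
      sum_matAction_outLayer_succ hfin hnobi hacyc hcol hfwd hgsupp k]
    linarith
end
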